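/- arXiv:1910.00868 — 3 statements merged into one kernel-verified Lean document; each statement's English description precedes it below -/
import Mathlib

section
/- Every vertex cover of Graph 2 that contains vertex 1 has at least 4 vertices. -/
/-- Graph 2: the simple graph on vertex set `{1,…,7}` with edge set
`{{1,2},{1,3},{1,4},{2,5},{2,6},{3,6},{3,7},{4,5},{4,7}}`. -/
def graph2 : SimpleGraph ℕ :=
  SimpleGraph.fromRel (fun i j =>
    (i, j) ∈ [(1,2),(1,3),(1,4),(2,5),(2,6),(3,6),(3,7),(4,5),(4,7)])

/-- A vertex cover of Graph 2: a subset of its vertex set `{1,…,7}` meeting every edge. -/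
def IsGraph2Cover (S : Finset ℕ) : Prop :=
  S ⊆ Finset.Icc 1 7 ∧ ∀ i j, graph2.Adj i j → i ∈ S ∨ j ∈ S

/-- Every vertex cover of Graph 2 that contains vertex 1 has at least 4 vertices. -/
theorem graph2_cover_with_one (S : Finset ℕ) (hS : IsGraph2Cover S) (h1 : 1 ∈ S) :
    4 ≤ S.card := by
  have a := hS.2 2 5 (by simp [graph2])
  have b := hS.2 4 7 (by simp [graph2])
  have c := hS.2 3 6 (by simp [graph2])
  have key : ∀ x y z : ℕ, x ∈ S → y ∈ S → z ∈ S →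
      ({1, x, y, z} : Finset ℕ).card = 4 → 4 ≤ S.card := by
    intro x y z hx hy hz h
    rw [← h]
    apply Finset.card_le_card
    intro w hw
    simp only [Finset.mem_insert, Finset.mem_singleton] at hw
    rcases hw with rfl | rfl | rfl | rfl <;> assumption
  rcases a with a | a <;> rcases b with b | b <;> rcases c with c | c <;>
    exact key _ _ _ a b c (by decide)
end

section
/- Let n > 0 and ε ∈ (0, 1/2] be real numbers, let O_a and O_r be real numbers with 0 < O_a ≤ O_r, let r ≥ 1 be real, and let w be any real number with 0 ≤ w ≤ εn. Then ((1−ε)·n·O_r + w·r·O_a + (εn − w)·r·O_r) / ((1−ε)·n·O_r + w·O_a + (εn − w)·O_r) ≥ 1 + ε·(r−1)·O_a / (ε·O_a + (1−ε)·O_r), with the minimum over w ∈ [0, εn] attained at w = εn. -/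
/-- Algebraic core of the lower-bound template for minimization problems.
The ratio is at least `1 + ε(r-1)·O_a / (ε·O_a + (1-ε)·O_r)` for every
`w ∈ [0, εn]`, and the minimum over `w` is attained at `w = εn`. -/
theorem minimization_template_ratio (n ε Oa Or r w : ℝ)
    (hn : 0 < n) (hε0 : 0 < ε) (hε : ε ≤ 1 / 2)
    (hOa : 0 < Oa) (hOaOr : Oa ≤ Or) (hr : 1 ≤ r)
    (hw0 : 0 ≤ w) (hw : w ≤ ε * n) :
    1 + ε * (r - 1) * Oa / (ε * Oa + (1 - ε) * Or) ≤
      ((1 - ε) * n * Or + w * r * Oa + (ε * n - w) * r * Or) /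
        ((1 - ε) * n * Or + w * Oa + (ε * n - w) * Or) ∧
    ((1 - ε) * n * Or + (ε * n) * r * Oa + (ε * n - ε * n) * r * Or) /
        ((1 - ε) * n * Or + (ε * n) * Oa + (ε * n - ε * n) * Or) =
      1 + ε * (r - 1) * Oa / (ε * Oa + (1 - ε) * Or) := by
  have hOr : 0 < Or := lt_of_lt_of_le hOa hOaOr
  have h1 : 0 < 1 - ε := by linarith
  have hE : 0 < ε * Oa + (1 - ε) * Or := by positivity
  have hx : 0 ≤ ε * n - w := by linarith
  have hD : 0 < (1 - ε) * n * Or + w * Oa + (ε * n - w) * Or := by positivity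
  have hD2 : 0 < (1 - ε) * n * Or + (ε * n) * Oa + (ε * n - ε * n) * Or := by
    rw [sub_self]
    positivity
  constructor
  · rw [one_add_div hE.ne', div_le_div_iff₀ hE hD]
    have key : 0 ≤ (r - 1) * ((1 - ε) * Or * ((ε * n - w) * (Or - Oa))) :=
      mul_nonneg (by linarith) (mul_nonneg (by positivity)
        (mul_nonneg hx (by linarith)))
    linarith
  · rw [one_add_div hE.ne', div_eq_div_iff hD2.ne' hE.ne']
    ring
end

section
/- Let n > 0 and ε ∈ (0, 1/2] be real numbers, let O_a and O_r be real numbers with 0 < O_a ≤ O_r, let r ≥ 1 be real, and let w be any real number with 0 ≤ w ≤ εn. Then ((1−ε)·n·O_r + w·O_a + (εn − w)·O_r) / ((1−ε)·n·O_r + (w/r)·O_a + ((εn − w)/r)·O_r) ≥ 1 + ε·(r−1)·O_a / ((1−ε)·r·O_r + ε·O_a), with the minimum over w ∈ [0, εn] attained at w = εn. -/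
/-- Algebraic core of the lower-bound template for maximization problems.
The ratio is at least `1 + ε(r-1)·O_a / ((1-ε)·r·O_r + ε·O_a)` for every
`w ∈ [0, εn]`, and the minimum over `w` is attained at `w = εn`. -/
theorem maximization_template_ratio (n ε Oa Or r w : ℝ)
    (hn : 0 < n) (hε0 : 0 < ε) (hε : ε ≤ 1 / 2)
    (hOa : 0 < Oa) (hOaOr : Oa ≤ Or) (hr : 1 ≤ r)
    (hw0 : 0 ≤ w) (hw : w ≤ ε * n) :
    1 + ε * (r - 1) * Oa / ((1 - ε) * r * Or + ε * Oa) ≤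
      ((1 - ε) * n * Or + w * Oa + (ε * n - w) * Or) /
        ((1 - ε) * n * Or + (w / r) * Oa + ((ε * n - w) / r) * Or) ∧
    ((1 - ε) * n * Or + (ε * n) * Oa + (ε * n - ε * n) * Or) /
        ((1 - ε) * n * Or + ((ε * n) / r) * Oa + ((ε * n - ε * n) / r) * Or) =
      1 + ε * (r - 1) * Oa / ((1 - ε) * r * Or + ε * Oa) := by
  have hr0 : 0 < r := by linarith
  have hOr : 0 < Or := by linarith
  have he : 0 < 1 - ε := by linarith
  have hD : 0 < (1 - ε) * r * Or + ε * Oa := by positivity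
  have hA : 0 < (1 - ε) * n * Or := by positivity
  have key : ∀ A X : ℝ, 0 < A → 0 < X → (A + X) / (A + X / r) = 1 + (r - 1) * X / (r * A + X) := by
    intro A X hA hX
    have h1 : 0 < r * A + X := by positivity
    have h2 : A + X / r = (r * A + X) / r := by field_simp
    rw [h2]
    field_simp
    ring
  constructor
  · have hX : ε * n * Oa ≤ w * Oa + (ε * n - w) * Or := by
      nlinarith [mul_nonneg (sub_nonneg.2 hw) (sub_nonneg.2 hOaOr)]
    have hX0 : 0 < w * Oa + (ε * n - w) * Or := lt_of_lt_of_le (by positivity) hX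
    have e := key _ _ hA hX0
    have e2 : ((1 - ε) * n * Or + w * Oa + (ε * n - w) * Or) /
        ((1 - ε) * n * Or + (w / r) * Oa + ((ε * n - w) / r) * Or) =
        ((1 - ε) * n * Or + (w * Oa + (ε * n - w) * Or)) /
        ((1 - ε) * n * Or + (w * Oa + (ε * n - w) * Or) / r) := by
      congr 1 <;> ring
    rw [e2, e]
    generalize w * Oa + (ε * n - w) * Or = X at *
    have hP : 0 < r * ((1 - ε) * n * Or) + X := by positivity
    have h3 : 0 ≤ ((r - 1) * (r * (1 - ε) * Or)) * (X - ε * n * Oa) :=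
      mul_nonneg (mul_nonneg (by linarith) (by positivity)) (by linarith)
    have h4 : ε * (r - 1) * Oa / ((1 - ε) * r * Or + ε * Oa) ≤
        (r - 1) * X / (r * ((1 - ε) * n * Or) + X) := by
      rw [div_le_div_iff₀ hD hP]
      linarith
    linarith
  · have e := key _ (ε * n * Oa) hA (by positivity)
    have e2 : ((1 - ε) * n * Or + (ε * n) * Oa + (ε * n - ε * n) * Or) /
        ((1 - ε) * n * Or + ((ε * n) / r) * Oa + ((ε * n - ε * n) / r) * Or) =
        ((1 - ε) * n * Or + ε * n * Oa) / ((1 - ε) * n * Or + ε * n * Oa / r) := by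
      congr 1 <;> ring
    rw [e2, e]
    congr 1
    have hP : 0 < r * ((1 - ε) * n * Or) + ε * n * Oa := by positivity
    rw [div_eq_div_iff hP.ne' hD.ne']
    ring
end
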